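/- arXiv:2112.15403 — 4 statements merged into one kernel-verified Lean document; each statement's English description precedes it below -/
import Mathlib

section
/- Let Z be a K×K real symmetric positive definite matrix and v ∈ ℝ^K. Then d((Z + vvᵀ)⁻¹ v vᵀ (Z + vvᵀ)⁻¹) ≤ d(Z⁻¹ v vᵀ Z⁻¹), where d(·) denotes the maximum diagonal entry of a square matrix; that is, the quantity t_max(S, j) = d(Z(S)⁻¹ v_j v_jᵀ Z(S)⁻¹) does not increase when the row v_j is added to Z(S). -/
open Matrix

theorem Matrix.IsSymm.mul_vecMulVec_mul_apply_self {n R : Type*} [Fintype n] [CommRing R]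
    {W : Matrix n n R} (hW : W.IsSymm) (v : n → R) (i : n) :
    (W * vecMulVec v v * W) i i = (W *ᵥ v) i ^ 2 := by
  rw [mul_vecMulVec, vecMulVec_mul, vecMulVec_apply, ← mulVec_transpose, hW.eq, sq]

/-- The action on `v` of the Sherman–Morrison formula. -/
theorem Matrix.PosDef.inv_mulVec_eq_smul_inv_add_vecMulVec_mulVec {n : Type*} [Fintype n]
    [DecidableEq n] {Z : Matrix n n ℝ} (hZ : Z.PosDef) (v : n → ℝ) :
    Z⁻¹ *ᵥ v = (1 + v ⬝ᵥ Z⁻¹ *ᵥ v) • ((Z + vecMulVec v v)⁻¹ *ᵥ v) := by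
  have hA : (Z + vecMulVec v v).PosDef :=
    hZ.add_posSemidef (by simpa using posSemidef_vecMulVec_self_star v)
  have hv : (Z + vecMulVec v v) *ᵥ (Z⁻¹ *ᵥ v) = (1 + v ⬝ᵥ Z⁻¹ *ᵥ v) • v := by
    rw [add_mulVec, mulVec_mulVec, mul_nonsing_inv _ ((isUnit_iff_isUnit_det _).1 hZ.isUnit),
      one_mulVec, vecMulVec_mulVec, add_smul, one_smul, op_smul_eq_smul]
  rw [← mulVec_smul, ← hv, mulVec_mulVec,
    nonsing_inv_mul _ ((isUnit_iff_isUnit_det _).1 hA.isUnit), one_mulVec]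

/-- For a K×K real symmetric positive definite Z and v ∈ ℝ^K, with d(·)
the maximum diagonal entry,
`d((Z + vvᵀ)⁻¹ v vᵀ (Z + vvᵀ)⁻¹) ≤ d(Z⁻¹ v vᵀ Z⁻¹)`. -/
theorem stmt_7 (K : ℕ) (Z : Matrix (Fin K) (Fin K) ℝ) (hZ : Z.PosDef)
    (v : Fin K → ℝ) :
    (⨆ i, ((Z + vecMulVec v v)⁻¹ * vecMulVec v v * (Z + vecMulVec v v)⁻¹) i i) ≤
      ⨆ i, (Z⁻¹ * vecMulVec v v * Z⁻¹) i i := by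
  have hZs : Z.IsSymm := (conjTranspose_eq_transpose_of_trivial Z).symm.trans hZ.isHermitian
  have hAs : (Z + vecMulVec v v).IsSymm := hZs.add (transpose_vecMulVec v v)
  have hc : 0 ≤ v ⬝ᵥ Z⁻¹ *ᵥ v := by
    simpa using hZ.inv.posSemidef.dotProduct_mulVec_nonneg v
  refine ciSup_mono (Set.finite_range _).bddAbove fun i => ?_
  rw [hAs.inv.mul_vecMulVec_mul_apply_self, hZs.inv.mul_vecMulVec_mul_apply_self,
    congrFun (hZ.inv_mulVec_eq_smul_inv_add_vecMulVec_mulVec v) i, Pi.smul_apply, smul_eq_mul,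
    mul_pow]
  exact le_mul_of_one_le_left (sq_nonneg _) (one_le_pow₀ (by linarith))
end

section
/- Let V be a finite set, M ≥ 1 an integer, and g a real-valued set function on subsets of V that is monotone decreasing and α-supermodular with 0 ≤ α ≤ 1. Let g* = min{g(S) : S ⊆ V, |S| = M}, and let S_0 = ∅, S_{k+1} = S_k ∪ {j_k} be the greedy sequence where j_k ∈ V \ S_k minimizes g(S_k ∪ {j}) over all j ∈ V \ S_k. Then for every l with 0 ≤ l ≤ |V|, g(S_l) − g* ≤ (1 − α/M)^l · (g(∅) − g*) ≤ e^{−αl/M} · (g(∅) − g*). -/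
open Finset

/-- For an `α`-supermodular function, `α` times the decrease caused by adjoining a set `T` to `A` is
at most `|T|` times any bound on the decreases caused by adjoining single elements to `A`. -/
theorem supermodular_union_decrease_le {ι : Type*} [DecidableEq ι] {g : Finset ι → ℝ} {α D : ℝ}
    (hsuper : ∀ A B : Finset ι, A ⊆ B → ∀ u ∉ B,
      g (insert u A) - g A ≤ α * (g (insert u B) - g B))
    {A : Finset ι} (hD : 0 ≤ D) (hA : ∀ u ∉ A, g A - g (insert u A) ≤ D) (T : Finset ι) :
    α * (g A - g (A ∪ T)) ≤ T.card * D := by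
  induction T using Finset.induction_on with
  | empty => simp
  | insert u T hu ih =>
    rw [card_insert_of_notMem hu, union_insert]
    push_cast
    by_cases hm : u ∈ A ∪ T
    · rw [insert_eq_of_mem hm]
      linarith
    · have h_drop := hsuper A (A ∪ T) subset_union_left u hm
      have h_single := hA u fun h => hm (mem_union_left T h)
      linarith

/-- For a finite set V, M ≥ 1, and a monotone decreasing,
α-supermodular (0 ≤ α ≤ 1) set function g, the greedy sequence S_0 = ∅,
S_{k+1} = S_k ∪ {j_k}, with j_k minimizing g(S_k ∪ {j}) over j ∉ S_k, satisfies
`g(S_l) − g* ≤ (1 − α/M)^l (g(∅) − g*) ≤ e^{−αl/M} (g(∅) − g*)` for 0 ≤ l ≤ |V|,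
where g* is the minimum of g over subsets of cardinality M. -/
theorem stmt_10 {ι : Type*} [Fintype ι] [DecidableEq ι]
    (g : Finset ι → ℝ) (α : ℝ) (hα0 : 0 ≤ α) (hα1 : α ≤ 1)
    (M : ℕ) (hM : 1 ≤ M)
    (hmono : ∀ A B : Finset ι, A ⊆ B → g B ≤ g A)
    (hsuper : ∀ A B : Finset ι, A ⊆ B → ∀ u ∉ B,
      g (insert u A) - g A ≤ α * (g (insert u B) - g B))
    (gstar : ℝ)
    (hstar : IsLeast {x : ℝ | ∃ S : Finset ι, S.card = M ∧ g S = x} gstar)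
    (S : ℕ → Finset ι) (hS0 : S 0 = ∅)
    (hgreedy : ∀ k < Fintype.card ι, ∃ j ∉ S k,
      S (k + 1) = insert j (S k) ∧
        ∀ j' ∉ S k, g (insert j (S k)) ≤ g (insert j' (S k))) :
    ∀ l ≤ Fintype.card ι,
      g (S l) - gstar ≤ (1 - α / M) ^ l * (g ∅ - gstar) ∧
      (1 - α / M) ^ l * (g ∅ - gstar) ≤
        Real.exp (-(α * l) / M) * (g ∅ - gstar) := by
  have hM1 : (1 : ℝ) ≤ M := by exact_mod_cast hM
  have hM0 : (0 : ℝ) < M := by linarith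
  have h_ratio : 0 ≤ 1 - α / M := by
    rw [sub_nonneg, div_le_one hM0]
    linarith
  obtain ⟨T, hT, hgT⟩ := hstar.1
  have h_step : ∀ k < Fintype.card ι,
      g (S (k + 1)) - gstar ≤ (1 - α / M) * (g (S k) - gstar) := by
    intro k hk
    obtain ⟨j, -, hSj, hmin⟩ := hgreedy k hk
    rw [hSj]
    have h_decrease := supermodular_union_decrease_le hsuper
      (sub_nonneg.2 (hmono (S k) _ (subset_insert j (S k))))
      (fun u hu => sub_le_sub_left (hmin u hu) (g (S k))) T
    have h_union : g (S k ∪ T) ≤ gstar := hgT ▸ hmono T _ subset_union_right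
    have h_gap : α * (g (S k) - gstar) ≤ (g (S k) - g (insert j (S k))) * M := by
      rw [hT] at h_decrease
      nlinarith [mul_le_mul_of_nonneg_left h_union hα0]
    have h_div := (div_le_iff₀ hM0).2 h_gap
    rw [mul_div_right_comm] at h_div
    linarith
  intro l hl
  constructor
  · induction l with
    | zero => simp [hS0]
    | succ k ih =>
      calc g (S (k + 1)) - gstar ≤ (1 - α / M) * (g (S k) - gstar) := h_step k hl
        _ ≤ (1 - α / M) * ((1 - α / M) ^ k * (g ∅ - gstar)) :=
          mul_le_mul_of_nonneg_left (ih (Nat.le_of_succ_le hl)) h_ratio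
        _ = (1 - α / M) ^ (k + 1) * (g ∅ - gstar) := by ring
  · have h_exp : Real.exp (-(α * l) / M) = Real.exp (-(α / M)) ^ l := by
      rw [← Real.exp_nat_mul]
      ring_nf
    rw [h_exp]
    exact mul_le_mul_of_nonneg_right
      (pow_le_pow_left₀ h_ratio (Real.one_sub_le_exp_neg _) l)
      (sub_nonneg.2 (hgT ▸ hmono ∅ T (empty_subset T)))
end

section
/- Let V be an N×K real matrix with orthonormal columns (VᵀV = I_K), rows v_1, …, v_N, μ > 0, and define g(S) = d(Z(S)⁻¹) where Z(S) = Σ_{i∈S} v_i v_iᵀ + μI_K and d(·) is the maximum diagonal entry. Set α = μ(2+μ)/(1+μ)². If g is α-supermodular, then for M ≥ 1 and the greedy sequence S_0 = ∅, S_{k+1} = S_k ∪ {j_k} with j_k ∈ {1,…,N} \ S_k minimizing g(S_k ∪ {j}), the greedy solution satisfies g(S_l) − g* ≤ e^{−αl/M}·(g(∅) − g*) for every l, where g* is the minimum of g over subsets of cardinality M. -/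
open Matrix Finset

section Supermodular

variable {ι : Type*} [DecidableEq ι] {g : Finset ι → ℝ} {α : ℝ}

/-- An `α`-supermodular function with `α < 1` is antitone. -/
theorem antitone_of_supermodular (hα : α < 1)
    (h : ∀ A B : Finset ι, A ⊆ B → ∀ u ∉ B,
      g (insert u A) - g A ≤ α * (g (insert u B) - g B)) : Antitone g := by
  refine Finset.antitone_iff_forall_insert_le.2 fun B u hu => ?_
  nlinarith [h B B subset_rfl u hu]

/-- If no single element decreases an `α`-supermodular function at `A` by more than `δ`, then
adjoining `T` to `A` decreases it by at most `#T * δ / α`. -/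
theorem mul_sub_union_le_card_mul {δ : ℝ} (hδ : 0 ≤ δ)
    (h : ∀ A B : Finset ι, A ⊆ B → ∀ u ∉ B,
      g (insert u A) - g A ≤ α * (g (insert u B) - g B))
    {A : Finset ι} (hA : ∀ u ∉ A, g A - g (insert u A) ≤ δ) (T : Finset ι) :
    α * (g A - g (A ∪ T)) ≤ T.card * δ := by
  induction T using Finset.induction_on with
  | empty => simp
  | insert u T hu ih =>
    rw [Finset.card_insert_of_notMem hu, Finset.union_insert]
    push_cast
    by_cases huAT : u ∈ A ∪ T
    · rw [Finset.insert_eq_of_mem huAT]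
      linarith
    · have huA : u ∉ A := fun hmem => huAT (Finset.mem_union_left T hmem)
      linarith [h A (A ∪ T) Finset.subset_union_left u huAT, hA u huA]

end Supermodular

/-- For an N×K real matrix V with orthonormal columns, rows v_1, …, v_N,
μ > 0, and g(S) = max diag (Σ_{i∈S} v_i v_iᵀ + μI)⁻¹, set α = μ(2+μ)/(1+μ)². If g is
α-supermodular, then for M ≥ 1 the greedy sequence S_0 = ∅, S_{k+1} = S_k ∪ {j_k}
(j_k minimizing g over augmented sets) satisfies
`g(S_l) − g* ≤ e^{−αl/M}·(g(∅) − g*)` for every l, where g* is the minimum of g over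
subsets of cardinality M. -/
theorem stmt_11 (N K : ℕ) (V : Matrix (Fin N) (Fin K) ℝ) (hV : Vᵀ * V = 1)
    (μ : ℝ) (hμ : 0 < μ)
    (g : Finset (Fin N) → ℝ)
    (hg : ∀ S : Finset (Fin N),
      g S = ⨆ i, ((∑ m ∈ S, vecMulVec (V m) (V m)
        + μ • (1 : Matrix (Fin K) (Fin K) ℝ))⁻¹) i i)
    (hsuper : ∀ A B : Finset (Fin N), A ⊆ B → ∀ u ∉ B,
      g (insert u A) - g A ≤ (μ * (2 + μ) / (1 + μ) ^ 2) * (g (insert u B) - g B))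
    (M : ℕ) (hM : 1 ≤ M)
    (gstar : ℝ)
    (hstar : IsLeast {x : ℝ | ∃ S : Finset (Fin N), S.card = M ∧ g S = x} gstar)
    (S : ℕ → Finset (Fin N)) (hS0 : S 0 = ∅)
    (hgreedy : ∀ k < N, ∃ j ∉ S k,
      S (k + 1) = insert j (S k) ∧
        ∀ j' ∉ S k, g (insert j (S k)) ≤ g (insert j' (S k))) :
    ∀ l ≤ N,
      g (S l) - gstar ≤
        Real.exp (-(μ * (2 + μ) / (1 + μ) ^ 2) * l / M) * (g ∅ - gstar) := by
  set α : ℝ := μ * (2 + μ) / (1 + μ) ^ 2 with hα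
  have hα1 : α < 1 := by
    rw [hα, div_lt_one (by positivity)]
    linarith
  have hM0 : (1 : ℝ) ≤ M := by exact_mod_cast hM
  have hanti : Antitone g := antitone_of_supermodular hα1 hsuper
  obtain ⟨⟨T, hTcard, rfl⟩, -⟩ := hstar
  have hcoef : 0 ≤ 1 - α / M := by
    rw [sub_nonneg, div_le_one (by linarith)]
    linarith
  have hstep : ∀ k < N, g (S (k + 1)) - g T ≤ (1 - α / M) * (g (S k) - g T) := by
    intro k hk
    obtain ⟨j, -, hj, hmin⟩ := hgreedy k hk
    have hδ : 0 ≤ g (S k) - g (S (k + 1)) := by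
      rw [hj]
      exact sub_nonneg.2 (hanti (Finset.subset_insert j (S k)))
    have hgain := mul_sub_union_le_card_mul hδ hsuper
      (fun u hu => by rw [hj]; exact sub_le_sub_left (hmin u hu) _) T
    rw [hTcard] at hgain
    have hα0 : 0 ≤ α := by positivity
    have hbound : α * (g (S k) - g T) ≤ M * (g (S k) - g (S (k + 1))) :=
      (mul_le_mul_of_nonneg_left
        (sub_le_sub_left (hanti Finset.subset_union_right) _) hα0).trans hgain
    have hdiv : α / M * (g (S k) - g T) ≤ g (S k) - g (S (k + 1)) := by
      rw [div_mul_eq_mul_div, div_le_iff₀ (by linarith)]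
      linarith
    linarith
  have hinit : 0 ≤ g ∅ - g T := sub_nonneg.2 (hanti (Finset.empty_subset T))
  intro l
  induction l with
  | zero => simp [hS0]
  | succ k ih =>
    intro hk
    calc g (S (k + 1)) - g T
        ≤ (1 - α / M) * (g (S k) - g T) := hstep k hk
      _ ≤ (1 - α / M) * (Real.exp (-α * k / M) * (g ∅ - g T)) :=
          mul_le_mul_of_nonneg_left (ih (Nat.le_of_succ_le hk)) hcoef
      _ ≤ Real.exp (-(α / M)) * (Real.exp (-α * k / M) * (g ∅ - g T)) := by
          gcongr
          exact Real.one_sub_le_exp_neg _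
      _ = Real.exp (-α * (k + 1 : ℕ) / M) * (g ∅ - g T) := by
          rw [← mul_assoc, ← Real.exp_add]
          congr 2
          push_cast
          ring
end

section
/- Let W be an M×K real matrix with M ≥ K ≥ 1 and let μ > 0. Then the maximum diagonal entry of (WWᵀ + μI_M)⁻¹ is at least the geometric mean of its eigenvalues, namely d((WWᵀ + μI_M)⁻¹) ≥ (μ^{−(M−K)} · det(WᵀW + μI_K)⁻¹)^{1/M}. -/
open Matrix Finset

theorem det_mul_add_smul_one_comm {m n F : Type*} [Fintype m] [Fintype n] [DecidableEq m]
    [DecidableEq n] [Field F] (A : Matrix m n F) (B : Matrix n m F) {c : F} (hc : c ≠ 0)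
    (h : Fintype.card n ≤ Fintype.card m) :
    (A * B + c • (1 : Matrix m m F)).det =
      c ^ (Fintype.card m - Fintype.card n) * (B * A + c • (1 : Matrix n n F)).det := by
  have hA : A * B + c • (1 : Matrix m m F) = c • (1 + (c⁻¹ • A) * B) := by
    rw [smul_add, smul_mul, smul_inv_smul₀ hc, add_comm]
  have hB : B * A + c • (1 : Matrix n n F) = c • (1 + B * (c⁻¹ • A)) := by
    rw [smul_add, Matrix.mul_smul, smul_inv_smul₀ hc, add_comm]
  rw [hA, hB, det_smul, det_smul, det_one_add_mul_comm, ← mul_assoc, ← pow_add,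
    Nat.sub_add_cancel h]

theorem Matrix.PosSemidef.det_rpow_inv_card_le_trace_div_card {n : Type*} [Fintype n]
    [DecidableEq n] [Nonempty n] {A : Matrix n n ℝ} (hA : A.PosSemidef) :
    A.det ^ ((Fintype.card n : ℝ)⁻¹) ≤ A.trace / Fintype.card n := by
  have h := Real.geom_mean_le_arith_mean univ (fun _ => 1) hA.isHermitian.eigenvalues
    (fun _ _ => zero_le_one) (by simp [Fintype.card_pos]) (fun i _ => hA.eigenvalues_nonneg i)
  simpa [hA.isHermitian.det_eq_prod_eigenvalues, hA.isHermitian.trace_eq_sum_eigenvalues] using h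

/-- For an M×K real matrix W with M ≥ K ≥ 1 and μ > 0, the maximum
diagonal entry of (WWᵀ + μI_M)⁻¹ is at least the geometric mean of its eigenvalues:
`d((WWᵀ + μI_M)⁻¹) ≥ (μ^{−(M−K)} · det (WᵀW + μI_K)⁻¹)^{1/M}`. -/
theorem stmt_12 (M K : ℕ) (hK : 1 ≤ K) (hKM : K ≤ M)
    (W : Matrix (Fin M) (Fin K) ℝ) (μ : ℝ) (hμ : 0 < μ) :
    (μ⁻¹ ^ (M - K) *
        ((Wᵀ * W + μ • (1 : Matrix (Fin K) (Fin K) ℝ))⁻¹).det) ^ ((M : ℝ)⁻¹) ≤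
      Finset.univ.sup' (Finset.univ_nonempty_iff.mpr ⟨⟨0, Nat.lt_of_lt_of_le hK hKM⟩⟩)
        (fun i => ((W * Wᵀ + μ • (1 : Matrix (Fin M) (Fin M) ℝ))⁻¹) i i) := by
  have hM : 0 < M := Nat.lt_of_lt_of_le hK hKM
  have : Nonempty (Fin M) := ⟨⟨0, hM⟩⟩
  have hpos : (W * Wᵀ + μ • (1 : Matrix (Fin M) (Fin M) ℝ))⁻¹.PosSemidef := by
    have h1 : (W * Wᵀ).PosSemidef := by
      simpa using posSemidef_self_mul_conjTranspose W
    exact (h1.add (PosSemidef.one.smul hμ.le)).inv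
  have hdet : μ⁻¹ ^ (M - K) * ((Wᵀ * W + μ • (1 : Matrix (Fin K) (Fin K) ℝ))⁻¹).det =
      ((W * Wᵀ + μ • (1 : Matrix (Fin M) (Fin M) ℝ))⁻¹).det := by
    rw [det_nonsing_inv, det_nonsing_inv, Ring.inverse_eq_inv',
      det_mul_add_smul_one_comm W Wᵀ hμ.ne' (by simpa using hKM), mul_inv, inv_pow]
    simp
  have h := hpos.det_rpow_inv_card_le_trace_div_card
  rw [Fintype.card_fin] at h
  rw [hdet]
  refine h.trans ?_
  rw [div_le_iff₀ (by exact_mod_cast hM), mul_comm, ← nsmul_eq_mul, Matrix.trace]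
  refine (Finset.sum_le_card_nsmul univ _ _ fun i hi => ?_).trans_eq (by rw [card_fin])
  exact Finset.le_sup' (fun i => ((W * Wᵀ + μ • (1 : Matrix (Fin M) (Fin M) ℝ))⁻¹) i i) hi
end
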